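/- Let k = Σ_{i=1}^m c_i k_i where m ≥ 1, each c_i ≥ 0, and each k_i : ℝ × ℝ → ℝ is a measurable kernel that is shift invariant, scale sensitive of order α_i > 0, and conditionally positive. Let α_* := min_{1 ≤ i ≤ m} α_i. Fix the distributional Bellman setup with discount γ ∈ [0, 1], and let μ, ν be two measurable families of Borel probability measures on ℝ indexed by S × A such that each k_i is integrable with respect to all product measures formed from μ(s,a), ν(s,a), (T^π μ)(s,a) and (T^π ν)(s,a) for every (s,a). Then the distributional Bellman operator T^π is a γ^{α_*/2}-contraction in supremum MMD: MMD_∞( T^π μ, T^π ν ; k ) ≤ γ^{α_*/2} · MMD_∞( μ, ν ; k ). -/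

import Mathlib

open MeasureTheory ProbabilityTheory Filter
open scoped ENNReal NNReal

noncomputable def mmdSq {X : Type*} [MeasurableSpace X] (k : X → X → ℝ) (p q : Measure X) : ℝ :=
  (∫ z : X × X, k z.1 z.2 ∂(p.prod p)) + (∫ z : X × X, k z.1 z.2 ∂(q.prod q)) -
    2 * ∫ z : X × X, k z.1 z.2 ∂(p.prod q)

noncomputable def mmd {X : Type*} [MeasurableSpace X] (k : X → X → ℝ) (p q : Measure X) : ℝ :=
  Real.sqrt (mmdSq k p q)

/-- The distributional Bellman operator `T^π`:
`(T^π μ)(s,a) = ∫∫∫ (f_{γ,r})_# μ(s',a') R(dr|s,a) π(da'|s') P(ds'|s,a)`. -/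
noncomputable def bellmanOp {S A : Type*} [MeasurableSpace S] [MeasurableSpace A]
    (P : Kernel (S × A) S) (R : Kernel (S × A) ℝ) (pol : Kernel S A) (γ : ℝ)
    (μ : S × A → Measure ℝ) : S × A → Measure ℝ := fun sa =>
  (P sa).bind fun s' => (pol s').bind fun a' => (R sa).bind fun r =>
    (μ (s', a')).map fun z => r + γ * z

/-- The supremum MMD of two families of return distributions indexed by `S × A`. -/
noncomputable def mmdSup {S A : Type*} [MeasurableSpace S] [MeasurableSpace A]
    (k : ℝ → ℝ → ℝ) (μ ν : S × A → Measure ℝ) : ℝ≥0∞ :=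
  ⨆ sa : S × A, ENNReal.ofReal (mmd k (μ sa) (ν sa))

/-- A kernel `k` is conditionally positive if `∫∫ k dχ dχ ≥ 0` for every finite signed Borel
measure `χ` with `χ(ℝ) = 0` (written as `χ = p - q` with `p, q` finite measures of equal total
mass) for which `k` is suitably integrable. -/
def CondPositive (k : ℝ → ℝ → ℝ) : Prop :=
  ∀ p q : Measure ℝ, IsFiniteMeasure p → IsFiniteMeasure q →
    p Set.univ = q Set.univ →
    Integrable (fun z : ℝ × ℝ => k z.1 z.2) (p.prod p) →
    Integrable (fun z : ℝ × ℝ => k z.1 z.2) (q.prod q) →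
    Integrable (fun z : ℝ × ℝ => k z.1 z.2) (p.prod q) →
    0 ≤ mmdSq k p q

/-- The kernel `k`, uncurried, is integrable against a product of measures. -/
def KernelIntegrable {X : Type*} [MeasurableSpace X] (k : X → X → ℝ) (p q : Measure X) : Prop :=
  Integrable (fun z : X × X => k z.1 z.2) (p.prod q)

lemma KernelIntegrable.symm {X : Type*} [MeasurableSpace X] {k : X → X → ℝ} {p q : Measure X}
    [SFinite p] [SFinite q] (hs : ∀ x y, k x y = k y x) (h : KernelIntegrable k p q) :
    KernelIntegrable k q p := by
  have h' := Integrable.swap h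
  simpa only [KernelIntegrable, Function.comp_def, Prod.fst_swap, Prod.snd_swap, hs] using h'

lemma integral_kernel_prod_symm {X : Type*} [MeasurableSpace X] {k : X → X → ℝ}
    (hs : ∀ x y, k x y = k y x) (p q : Measure X) [SFinite p] [SFinite q] :
    ∫ z : X × X, k z.1 z.2 ∂(q.prod p) = ∫ z : X × X, k z.1 z.2 ∂(p.prod q) := by
  rw [← integral_prod_swap (μ := p) (ν := q) (fun z : X × X => k z.1 z.2)]
  exact integral_congr_ae (ae_of_all _ fun z => hs _ _)

lemma KernelIntegrable.add_left {X : Type*} [MeasurableSpace X] {k : X → X → ℝ}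
    {p p' q : Measure X} [SFinite p] [SFinite p'] [SFinite q]
    (h : KernelIntegrable k p q) (h' : KernelIntegrable k p' q) :
    KernelIntegrable k (p + p') q := by
  rw [KernelIntegrable, Measure.add_prod]
  exact integrable_add_measure.2 ⟨h, h'⟩

lemma KernelIntegrable.add_right {X : Type*} [MeasurableSpace X] {k : X → X → ℝ}
    {p q q' : Measure X} [SFinite p] [SFinite q] [SFinite q']
    (h : KernelIntegrable k p q) (h' : KernelIntegrable k p q') :
    KernelIntegrable k p (q + q') := by
  rw [KernelIntegrable, Measure.prod_add]
  exact integrable_add_measure.2 ⟨h, h'⟩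

lemma integral_kernel_add_prod_add {X : Type*} [MeasurableSpace X] {k : X → X → ℝ}
    {p p' q q' : Measure X} [SFinite p] [SFinite p'] [SFinite q] [SFinite q']
    (h₁ : KernelIntegrable k p q) (h₂ : KernelIntegrable k p q')
    (h₃ : KernelIntegrable k p' q) (h₄ : KernelIntegrable k p' q') :
    ∫ z : X × X, k z.1 z.2 ∂((p + p').prod (q + q')) =
      ∫ z : X × X, k z.1 z.2 ∂(p.prod q) + ∫ z : X × X, k z.1 z.2 ∂(p.prod q') +
      (∫ z : X × X, k z.1 z.2 ∂(p'.prod q) + ∫ z : X × X, k z.1 z.2 ∂(p'.prod q')) := by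
  rw [Measure.add_prod, integral_add_measure (h₁.add_right h₂) (h₃.add_right h₄),
    Measure.prod_add, Measure.prod_add, integral_add_measure h₁ h₂, integral_add_measure h₃ h₄]

/-- The bilinear form of a conditionally positive kernel, evaluated at `p₁ - q₁` and `p₂ - q₂`, is
at most the arithmetic mean of its values on the diagonal. -/
lemma CondPositive.cross_le {k : ℝ → ℝ → ℝ} (hpos : CondPositive k) (hs : ∀ x y, k x y = k y x)
    {p₁ q₁ p₂ q₂ : Measure ℝ} [IsProbabilityMeasure p₁] [IsProbabilityMeasure q₁]
    [IsProbabilityMeasure p₂] [IsProbabilityMeasure q₂]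
    (hp₁ : KernelIntegrable k p₁ p₁) (hq₁ : KernelIntegrable k q₁ q₁)
    (hpq₁ : KernelIntegrable k p₁ q₁)
    (hp₂ : KernelIntegrable k p₂ p₂) (hq₂ : KernelIntegrable k q₂ q₂)
    (hpq₂ : KernelIntegrable k p₂ q₂)
    (hpp : KernelIntegrable k p₁ p₂) (hqq : KernelIntegrable k q₁ q₂)
    (hpq : KernelIntegrable k p₁ q₂) (hqp : KernelIntegrable k q₁ p₂) :
    ∫ z : ℝ × ℝ, k z.1 z.2 ∂(p₁.prod p₂) + ∫ z : ℝ × ℝ, k z.1 z.2 ∂(q₁.prod q₂) -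
        ∫ z : ℝ × ℝ, k z.1 z.2 ∂(p₁.prod q₂) - ∫ z : ℝ × ℝ, k z.1 z.2 ∂(q₁.prod p₂) ≤
      (mmdSq k p₁ q₁ + mmdSq k p₂ q₂) / 2 := by
  have h := hpos (p₁ + q₂) (q₁ + p₂) inferInstance inferInstance (by simp)
    ((hp₁.add_right hpq).add_left ((hpq.symm hs).add_right hq₂))
    ((hq₁.add_right hqp).add_left ((hqp.symm hs).add_right hp₂))
    ((hpq₁.add_right hpp).add_left ((hqq.symm hs).add_right (hpq₂.symm hs)))
  rw [mmdSq, integral_kernel_add_prod_add hp₁ hpq (hpq.symm hs) hq₂,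
    integral_kernel_add_prod_add hq₁ hqp (hqp.symm hs) hp₂,
    integral_kernel_add_prod_add hpq₁ hpp (hqq.symm hs) (hpq₂.symm hs),
    integral_kernel_prod_symm hs p₁ q₂, integral_kernel_prod_symm hs q₁ p₂,
    integral_kernel_prod_symm hs q₁ q₂, integral_kernel_prod_symm hs p₂ q₂] at h
  simp only [mmdSq]
  linarith

section Mixture

variable {Ω Y : Type*} [MeasurableSpace Ω] [MeasurableSpace Y]

lemma comp_prod_comp (Λ : Measure Ω) [SFinite Λ] (κ η : Kernel Ω Y) [IsSFiniteKernel κ]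
    [IsSFiniteKernel η] :
    (κ ∘ₘ Λ).prod (η ∘ₘ Λ) = (κ ∥ₖ η) ∘ₘ (Λ.prod Λ) := by
  rw [Measure.prod_comp_right, Measure.prod_comp_left, Measure.comp_assoc,
    Kernel.parallelComp_comp_parallelComp, Kernel.id_comp, Kernel.comp_id]

lemma KernelIntegrable.ae_of_comp {k : Y → Y → ℝ} {Λ : Measure Ω} [SFinite Λ] {κ η : Kernel Ω Y}
    [IsSFiniteKernel κ] [IsSFiniteKernel η] (h : KernelIntegrable k (κ ∘ₘ Λ) (η ∘ₘ Λ)) :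
    ∀ᵐ u ∂(Λ.prod Λ), KernelIntegrable k (κ u.1) (η u.2) := by
  rw [KernelIntegrable, comp_prod_comp] at h
  simpa only [KernelIntegrable, Kernel.parallelComp_apply] using
    Measure.ae_integrable_of_integrable_comp h

lemma KernelIntegrable.integrable_comp {k : Y → Y → ℝ} {Λ : Measure Ω} [SFinite Λ]
    {κ η : Kernel Ω Y} [IsSFiniteKernel κ] [IsSFiniteKernel η]
    (h : KernelIntegrable k (κ ∘ₘ Λ) (η ∘ₘ Λ)) :
    Integrable (fun u : Ω × Ω => ∫ z : Y × Y, k z.1 z.2 ∂((κ u.1).prod (η u.2))) (Λ.prod Λ) := by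
  rw [KernelIntegrable, comp_prod_comp, Measure.comp_eq_comp_const_apply] at h
  simpa only [Kernel.parallelComp_apply, Kernel.const_apply] using Integrable.integral_comp h

lemma KernelIntegrable.integral_comp {k : Y → Y → ℝ} {Λ : Measure Ω} [SFinite Λ]
    {κ η : Kernel Ω Y} [IsSFiniteKernel κ] [IsSFiniteKernel η]
    (h : KernelIntegrable k (κ ∘ₘ Λ) (η ∘ₘ Λ)) :
    ∫ z : Y × Y, k z.1 z.2 ∂((κ ∘ₘ Λ).prod (η ∘ₘ Λ)) =
      ∫ u : Ω × Ω, ∫ z : Y × Y, k z.1 z.2 ∂((κ u.1).prod (η u.2)) ∂(Λ.prod Λ) := by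
  rw [KernelIntegrable, comp_prod_comp, Measure.comp_eq_comp_const_apply] at h
  rw [comp_prod_comp, Measure.comp_eq_comp_const_apply, Kernel.integral_comp h]
  simp only [Kernel.parallelComp_apply, Kernel.const_apply]

/-- Squared MMD of a conditionally positive kernel does not increase under mixing. -/
lemma CondPositive.mmdSq_comp_le {k : ℝ → ℝ → ℝ} (hpos : CondPositive k)
    (hs : ∀ x y, k x y = k y x) (Λ : Measure Ω) [IsProbabilityMeasure Λ] (κ η : Kernel Ω ℝ)
    [IsMarkovKernel κ] [IsMarkovKernel η]
    (hκ : ∀ u, KernelIntegrable k (κ u) (κ u)) (hη : ∀ u, KernelIntegrable k (η u) (η u))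
    (hκη : ∀ u, KernelIntegrable k (κ u) (η u))
    (iκκ : KernelIntegrable k (κ ∘ₘ Λ) (κ ∘ₘ Λ)) (iηη : KernelIntegrable k (η ∘ₘ Λ) (η ∘ₘ Λ))
    (iκη : KernelIntegrable k (κ ∘ₘ Λ) (η ∘ₘ Λ))
    {C : ℝ} (hC : ∀ u, mmdSq k (κ u) (η u) ≤ C) :
    mmdSq k (κ ∘ₘ Λ) (η ∘ₘ Λ) ≤ C := by
  have iηκ : KernelIntegrable k (η ∘ₘ Λ) (κ ∘ₘ Λ) := iκη.symm hs
  let F (κ η : Kernel Ω ℝ) (u : Ω × Ω) : ℝ := ∫ z : ℝ × ℝ, k z.1 z.2 ∂((κ u.1).prod (η u.2))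
  have jκκ : Integrable (F κ κ) (Λ.prod Λ) := iκκ.integrable_comp
  have jηη : Integrable (F η η) (Λ.prod Λ) := iηη.integrable_comp
  have jκη : Integrable (F κ η) (Λ.prod Λ) := iκη.integrable_comp
  have jηκ : Integrable (F η κ) (Λ.prod Λ) := iηκ.integrable_comp
  have jadd : Integrable (fun u => F κ κ u + F η η u) (Λ.prod Λ) := jκκ.add jηη
  have jsub : Integrable (fun u => F κ κ u + F η η u - F κ η u) (Λ.prod Λ) := jadd.sub jκη
  have hmix : mmdSq k (κ ∘ₘ Λ) (η ∘ₘ Λ) =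
      ∫ u, (F κ κ u + F η η u - F κ η u - F η κ u) ∂(Λ.prod Λ) := by
    have hsymm := integral_kernel_prod_symm hs (κ ∘ₘ Λ) (η ∘ₘ Λ)
    rw [iηκ.integral_comp, iκη.integral_comp] at hsymm
    rw [integral_sub jsub jηκ, integral_sub jadd jκη, integral_add jκκ jηη, mmdSq,
      iκκ.integral_comp, iηη.integral_comp, iκη.integral_comp]
    simp only [F]
    linarith
  rw [hmix]
  calc _ ≤ ∫ _ : Ω × Ω, C ∂(Λ.prod Λ) := by
        refine integral_mono_ae (jsub.sub jηκ) (integrable_const C) ?_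
        filter_upwards [iκκ.ae_of_comp, iηη.ae_of_comp, iκη.ae_of_comp, iηκ.ae_of_comp]
          with u h₁ h₂ h₃ h₄
        have h := hpos.cross_le hs (hκ u.1) (hη u.1) (hκη u.1) (hκ u.2) (hη u.2) (hκη u.2)
          h₁ h₂ h₃ h₄
        simp only [F]
        linarith [hC u.1, hC u.2]
    _ = C := by simp

end Mixture

section Combination

variable {ι X : Type*} [Fintype ι] [MeasurableSpace X]

lemma KernelIntegrable.sum {kk : ι → X → X → ℝ} {p q : Measure X}
    (h : ∀ i, KernelIntegrable (kk i) p q) (c : ι → ℝ) :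
    KernelIntegrable (fun x y => ∑ i, c i * kk i x y) p q :=
  integrable_finsetSum _ fun i _ => (h i).const_mul (c i)

lemma integral_kernel_sum {kk : ι → X → X → ℝ} {c : ι → ℝ} {p q : Measure X}
    (h : ∀ i, c i ≠ 0 → KernelIntegrable (kk i) p q) :
    ∫ z : X × X, ∑ i, c i * kk i z.1 z.2 ∂(p.prod q) =
      ∑ i, c i * ∫ z : X × X, kk i z.1 z.2 ∂(p.prod q) := by
  rw [integral_finsetSum]
  · simp only [integral_const_mul]
  · intro i _
    by_cases hi : c i = 0
    · simp [hi]
    · exact (h i hi).const_mul (c i)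

lemma mmdSq_sum {kk : ι → X → X → ℝ} {c : ι → ℝ} {p q : Measure X}
    (hp : ∀ i, c i ≠ 0 → KernelIntegrable (kk i) p p)
    (hq : ∀ i, c i ≠ 0 → KernelIntegrable (kk i) q q)
    (hpq : ∀ i, c i ≠ 0 → KernelIntegrable (kk i) p q) :
    mmdSq (fun x y => ∑ i, c i * kk i x y) p q = ∑ i, c i * mmdSq (kk i) p q := by
  simp only [mmdSq, integral_kernel_sum hp, integral_kernel_sum hq, integral_kernel_sum hpq,
    Finset.mul_sum, ← Finset.sum_add_distrib, ← Finset.sum_sub_distrib]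
  exact Finset.sum_congr rfl fun i _ => by ring

lemma KernelIntegrable.of_sum {kk : ι → X → X → ℝ} {c : ι → ℝ} (hc : ∀ i, 0 ≤ c i)
    (hm : ∀ i, Measurable fun z : X × X => kk i z.1 z.2) (hneg : ∀ i x y, kk i x y ≤ 0)
    {p q : Measure X} (h : KernelIntegrable (fun x y => ∑ i, c i * kk i x y) p q) (i : ι)
    (hi : c i ≠ 0) : KernelIntegrable (kk i) p q := by
  have hci : Integrable (fun z : X × X => c i * kk i z.1 z.2) (p.prod q) := by
    refine Integrable.mono h ((hm i).const_mul (c i)).aestronglyMeasurable (ae_of_all _ fun z => ?_)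
    have hterm : ∀ j, c j * kk j z.1 z.2 ≤ 0 := fun j =>
      mul_nonpos_of_nonneg_of_nonpos (hc j) (hneg j _ _)
    rw [Real.norm_of_nonpos (hterm i), Real.norm_of_nonpos (Finset.sum_nonpos fun j _ => hterm j),
      ← Finset.sum_neg_distrib]
    exact Finset.single_le_sum (f := fun j => -(c j * kk j z.1 z.2))
      (fun j _ => neg_nonneg.2 (hterm j)) (Finset.mem_univ i)
  have hki := hci.const_mul (c i)⁻¹
  simpa only [KernelIntegrable, inv_mul_cancel_left₀ hi] using hki

/-- Nonnegative combinations of nonpositive conditionally positive kernels are conditionally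
positive. -/
lemma CondPositive.sum {kk : ι → ℝ → ℝ → ℝ} {c : ι → ℝ} (hc : ∀ i, 0 ≤ c i)
    (hm : ∀ i, Measurable fun z : ℝ × ℝ => kk i z.1 z.2) (hneg : ∀ i x y, kk i x y ≤ 0)
    (hpos : ∀ i, CondPositive (kk i)) : CondPositive fun x y => ∑ i, c i * kk i x y := by
  intro p q hp hq hmass ip iq ipq
  have jp := KernelIntegrable.of_sum hc hm hneg ip
  have jq := KernelIntegrable.of_sum hc hm hneg iq
  have jpq := KernelIntegrable.of_sum hc hm hneg ipq
  rw [mmdSq_sum jp jq jpq]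
  refine Finset.sum_nonneg fun i _ => ?_
  by_cases hi : c i = 0
  · simp [hi]
  · exact mul_nonneg (hc i) (hpos i p q hp hq hmass (jp i hi) (jq i hi) (jpq i hi))

end Combination

section ShiftScale

variable {k : ℝ → ℝ → ℝ} {α : ℝ}

lemma kernel_symm_of_shift_of_scale (hshift : ∀ x y c, k (x + c) (y + c) = k x y)
    (hscale : ∀ x y c, k (c * x) (c * y) = |c| ^ α * k x y) (x y : ℝ) : k x y = k y x := by
  have h := hscale x y (-1)
  rw [← hshift _ _ (x + y)] at h
  simpa using h.symm

lemma kernel_self_eq_zero (hα : 0 < α) (hshift : ∀ x y c, k (x + c) (y + c) = k x y)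
    (hscale : ∀ x y c, k (c * x) (c * y) = |c| ^ α * k x y) (x : ℝ) : k x x = 0 := by
  have h := hscale 0 0 0
  have h' := hshift 0 0 x
  simp [Real.zero_rpow hα.ne'] at h
  simpa [h] using h'

lemma CondPositive.kernel_nonpos (hpos : CondPositive k)
    (hm : Measurable fun z : ℝ × ℝ => k z.1 z.2) (hdiag : ∀ x, k x x = 0) (x y : ℝ) :
    k x y ≤ 0 := by
  have hi : ∀ a b : ℝ, KernelIntegrable k (Measure.dirac a) (Measure.dirac b) := fun a b => by
    rw [KernelIntegrable, Measure.dirac_prod_dirac]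
    exact integrable_dirac' hm.stronglyMeasurable (by simp)
  have h := hpos (Measure.dirac x) (Measure.dirac y) inferInstance inferInstance (by simp)
    (hi x x) (hi y y) (hi x y)
  simp only [mmdSq, Measure.dirac_prod_dirac] at h
  simp only [integral_dirac, hdiag] at h
  linarith

lemma kernel_affine (hshift : ∀ x y c, k (x + c) (y + c) = k x y)
    (hscale : ∀ x y c, k (c * x) (c * y) = |c| ^ α * k x y) (r γ x y : ℝ) :
    k (r + γ * x) (r + γ * y) = |γ| ^ α * k x y := by
  rw [add_comm r, add_comm r, hshift, hscale]

lemma prod_map_affine (r γ : ℝ) (p q : Measure ℝ) [SFinite p] [SFinite q] :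
    (p.map fun z => r + γ * z).prod (q.map fun z => r + γ * z) =
      (p.prod q).map (Prod.map (fun z => r + γ * z) fun z => r + γ * z) :=
  Measure.map_prod_map p q (by fun_prop) (by fun_prop)

lemma KernelIntegrable.map_affine (hm : Measurable fun z : ℝ × ℝ => k z.1 z.2)
    (hshift : ∀ x y c, k (x + c) (y + c) = k x y)
    (hscale : ∀ x y c, k (c * x) (c * y) = |c| ^ α * k x y) {p q : Measure ℝ} [SFinite p]
    [SFinite q] (h : KernelIntegrable k p q) (r γ : ℝ) :
    KernelIntegrable k (p.map fun z => r + γ * z) (q.map fun z => r + γ * z) := by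
  rw [KernelIntegrable, prod_map_affine,
    integrable_map_measure hm.aestronglyMeasurable (by fun_prop)]
  simpa only [Function.comp_def, Prod.map_fst, Prod.map_snd, kernel_affine hshift hscale]
    using h.const_mul (|γ| ^ α)

lemma mmdSq_map_affine (hm : Measurable fun z : ℝ × ℝ => k z.1 z.2)
    (hshift : ∀ x y c, k (x + c) (y + c) = k x y)
    (hscale : ∀ x y c, k (c * x) (c * y) = |c| ^ α * k x y) (p q : Measure ℝ) [SFinite p]
    [SFinite q] (r γ : ℝ) :
    mmdSq k (p.map fun z => r + γ * z) (q.map fun z => r + γ * z) = |γ| ^ α * mmdSq k p q := by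
  have h : ∀ (p q : Measure ℝ) [SFinite p] [SFinite q],
      ∫ z : ℝ × ℝ, k z.1 z.2 ∂((p.map fun z => r + γ * z).prod (q.map fun z => r + γ * z)) =
        |γ| ^ α * ∫ z : ℝ × ℝ, k z.1 z.2 ∂(p.prod q) := fun p q _ _ => by
    rw [prod_map_affine, integral_map (by fun_prop) hm.aestronglyMeasurable]
    simp only [Prod.map_fst, Prod.map_snd, kernel_affine hshift hscale, integral_const_mul]
  simp only [mmdSq, h]
  ring

end ShiftScale

section Bellman

variable {S A : Type*} [MeasurableSpace S] [MeasurableSpace A]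

/-- The kernel `((s, a), r) ↦ (f_{γ,r})_# μ(s,a)`. -/
noncomputable def affineKernel (γ : ℝ) (κ : Kernel (S × A) ℝ) : Kernel ((S × A) × ℝ) ℝ :=
  (Kernel.prodMkRight ℝ κ ×ₖ Kernel.deterministic Prod.snd measurable_snd).map
    fun z : ℝ × ℝ => z.2 + γ * z.1

instance (γ : ℝ) (κ : Kernel (S × A) ℝ) [IsMarkovKernel κ] :
    IsMarkovKernel (affineKernel γ κ) :=
  Kernel.IsMarkovKernel.map _ (by fun_prop)

lemma affineKernel_apply (γ : ℝ) (κ : Kernel (S × A) ℝ) [IsMarkovKernel κ]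
    (u : (S × A) × ℝ) : affineKernel γ κ u = (κ u.1).map fun z => u.2 + γ * z := by
  rw [affineKernel, Kernel.map_apply _ (by fun_prop), Kernel.prod_apply,
    Kernel.deterministic_apply, Kernel.prodMkRight_apply, Measure.prod_dirac,
    Measure.map_map (by fun_prop) (by fun_prop)]
  rfl

lemma measurable_bind_prodMk {Ω Y : Type*} [MeasurableSpace Ω] [MeasurableSpace Y]
    (ρ : Measure ℝ) [SFinite ρ] (K : Kernel (Ω × ℝ) Y) :
    Measurable fun w => ρ.bind fun r => K (w, r) := by
  refine Measure.measurable_of_measurable_coe _ fun s hs => ?_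
  have h : ∀ w, (ρ.bind fun r => K (w, r)) s = ∫⁻ r, K (w, r) s ∂ρ := fun w =>
    Measure.bind_apply hs (K.measurable.comp measurable_prodMk_left).aemeasurable
  simp only [h]
  exact (K.measurable_coe hs).lintegral_prod_right'

/-- The Bellman operator is a single mixture over next state, next action and reward. -/
lemma bellmanOp_eq_comp (P : Kernel (S × A) S) [IsMarkovKernel P] (R : Kernel (S × A) ℝ)
    [IsMarkovKernel R] (pol : Kernel S A) [IsMarkovKernel pol] (γ : ℝ) (κ : Kernel (S × A) ℝ)
    [IsMarkovKernel κ] (sa : S × A) :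
    bellmanOp P R pol γ κ sa = affineKernel γ κ ∘ₘ (((P sa) ⊗ₘ pol).prod (R sa)) := by
  have hinner := measurable_bind_prodMk (R sa) (affineKernel γ κ)
  simp only [bellmanOp]
  refine Measure.ext fun s hs => ?_
  have hmid : Measurable fun s' => (pol s').bind fun a' => (R sa).bind fun r =>
      affineKernel γ κ ((s', a'), r) := by
    refine Measure.measurable_of_measurable_coe _ fun t ht => ?_
    have h : ∀ s', ((pol s').bind fun a' => (R sa).bind fun r =>
        affineKernel γ κ ((s', a'), r)) t =
        ∫⁻ a', ((R sa).bind fun r => affineKernel γ κ ((s', a'), r)) t ∂(pol s') := fun s' =>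
      Measure.bind_apply ht (hinner.comp measurable_prodMk_left).aemeasurable
    simp only [h]
    exact Measurable.lintegral_kernel_prod_right'
      (f := fun w => ((R sa).bind fun r => affineKernel γ κ (w, r)) t)
      ((Measure.measurable_coe ht).comp hinner)
  have hκ : ∀ s' a' r, (κ (s', a')).map (fun z => r + γ * z) =
      affineKernel γ κ ((s', a'), r) := fun s' a' r =>
    (affineKernel_apply γ κ ((s', a'), r)).symm
  simp only [hκ]
  rw [Measure.bind_apply hs hmid.aemeasurable, Measure.bind_apply hs (Kernel.aemeasurable _),
    lintegral_prod _ ((affineKernel γ κ).measurable_coe hs).aemeasurable,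
    Measure.lintegral_compProd ((affineKernel γ κ).measurable_coe hs).lintegral_prod_right']
  refine lintegral_congr fun s' => ?_
  refine (Measure.bind_apply hs (hinner.comp measurable_prodMk_left).aemeasurable).trans
    (lintegral_congr fun a' => ?_)
  exact Measure.bind_apply hs
    ((affineKernel γ κ).measurable.comp measurable_prodMk_left).aemeasurable

lemma bellmanOp_zero (P : Kernel (S × A) S) (R : Kernel (S × A) ℝ) (pol : Kernel S A)
    (μ ν : S × A → Measure ℝ) (hμ : ∀ sa, IsProbabilityMeasure (μ sa))
    (hν : ∀ sa, IsProbabilityMeasure (ν sa)) :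
    bellmanOp P R pol 0 μ = bellmanOp P R pol 0 ν := by
  funext sa
  simp [bellmanOp, Measure.map_const]

end Bellman

lemma mmd_self {X : Type*} [MeasurableSpace X] (k : X → X → ℝ) (p : Measure X) :
    mmd k p p = 0 := by
  rw [mmd, mmdSq]
  ring_nf
  exact Real.sqrt_zero

/-- for `k = Σ cᵢ kᵢ` with each `kᵢ` shift invariant, scale sensitive of order
`αᵢ > 0` and conditionally positive, and `cᵢ ≥ 0`, the distributional Bellman operator is a
`γ^{α_*/2}`-contraction in `MMD_∞`, where `α_* = minᵢ αᵢ`. -/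
theorem bellman_contraction_sum_kernels
    {S A : Type*} [MeasurableSpace S] [MeasurableSpace A]
    (m : ℕ) (hm : 1 ≤ m)
    (kk : Fin m → ℝ → ℝ → ℝ) (c : Fin m → ℝ) (hc : ∀ i, 0 ≤ c i)
    (hkm : ∀ i, Measurable fun z : ℝ × ℝ => kk i z.1 z.2)
    (α : Fin m → ℝ) (hα : ∀ i, 0 < α i)
    (hshift : ∀ i, ∀ x y cc : ℝ, kk i (x + cc) (y + cc) = kk i x y)
    (hscale : ∀ i, ∀ x y cc : ℝ, kk i (cc * x) (cc * y) = |cc| ^ (α i) * kk i x y)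
    (hpos : ∀ i, CondPositive (kk i))
    (k : ℝ → ℝ → ℝ) (hk : ∀ x y, k x y = ∑ i, c i * kk i x y)
    (P : Kernel (S × A) S) [IsMarkovKernel P]
    (R : Kernel (S × A) ℝ) [IsMarkovKernel R]
    (pol : Kernel S A) [IsMarkovKernel pol]
    (γ : ℝ) (hγ : γ ∈ Set.Icc (0 : ℝ) 1)
    (μ ν : S × A → Measure ℝ) (hμm : Measurable μ) (hνm : Measurable ν)
    (hμp : ∀ sa, IsProbabilityMeasure (μ sa)) (hνp : ∀ sa, IsProbabilityMeasure (ν sa))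
    (hint : ∀ i : Fin m, ∀ sa : S × A,
      ∀ p ∈ ({μ sa, ν sa, bellmanOp P R pol γ μ sa, bellmanOp P R pol γ ν sa} :
        Set (Measure ℝ)),
      ∀ q ∈ ({μ sa, ν sa, bellmanOp P R pol γ μ sa, bellmanOp P R pol γ ν sa} :
        Set (Measure ℝ)),
      Integrable (fun z : ℝ × ℝ => kk i z.1 z.2) (p.prod q)) :
    mmdSup k (bellmanOp P R pol γ μ) (bellmanOp P R pol γ ν)
      ≤ ENNReal.ofReal (γ ^ ((⨅ i, α i) / 2)) * mmdSup k μ ν := by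
  have : Nonempty (Fin m) := ⟨⟨0, hm⟩⟩
  have hinf : 0 < ⨅ i, α i := by
    obtain ⟨i, hi⟩ := exists_eq_ciInf_of_finite (f := α)
    exact hi ▸ hα i
  rcases hγ.1.eq_or_lt with rfl | hγ0
  · rw [bellmanOp_zero P R pol μ ν hμp hνp]
    simp [mmdSup, mmd_self]
  rcases eq_or_ne (mmdSup k μ ν) ∞ with htop | htop
  · rw [htop, ENNReal.mul_top]
    · exact le_top
    · simpa using Real.rpow_pos_of_pos hγ0 _
  obtain rfl : k = fun x y => ∑ i, c i * kk i x y := funext₂ hk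
  set k : ℝ → ℝ → ℝ := fun x y => ∑ i, c i * kk i x y
  set M := (mmdSup k μ ν).toReal
  have hM : ∀ w, mmdSq k (μ w) (ν w) ≤ M ^ 2 := fun w => by
    have h : mmd k (μ w) (ν w) ≤ M :=
      (ENNReal.ofReal_le_iff_le_toReal htop).1
        (le_iSup (fun sa => ENNReal.ofReal (mmd k (μ sa) (ν sa))) w)
    exact (Real.sqrt_le_iff.1 h).2
  have hsymm : ∀ i x y, kk i x y = kk i y x := fun i =>
    kernel_symm_of_shift_of_scale (hshift i) (hscale i)
  have hneg : ∀ i x y, kk i x y ≤ 0 := fun i =>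
    (hpos i).kernel_nonpos (hkm i) (kernel_self_eq_zero (hα i) (hshift i) (hscale i))
  have hkpos : CondPositive k := CondPositive.sum hc hkm hneg hpos
  have hksymm : ∀ x y, k x y = k y x := fun x y =>
    Finset.sum_congr rfl fun i _ => by rw [hsymm i x y]
  have hμμ : ∀ i w, KernelIntegrable (kk i) (μ w) (μ w) := fun i w =>
    hint i w _ (by simp) _ (by simp)
  have hνν : ∀ i w, KernelIntegrable (kk i) (ν w) (ν w) := fun i w =>
    hint i w _ (by simp) _ (by simp)
  have hμν : ∀ i w, KernelIntegrable (kk i) (μ w) (ν w) := fun i w =>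
    hint i w _ (by simp) _ (by simp)
  have haff : ∀ {p q : Measure ℝ} [SFinite p] [SFinite q] (_ : ∀ i, KernelIntegrable (kk i) p q)
      (r : ℝ) (i : Fin m),
      KernelIntegrable (kk i) (p.map fun z => r + γ * z) (q.map fun z => r + γ * z) :=
    fun h r i => (h i).map_affine (hkm i) (hshift i) (hscale i) r γ
  let κ : Kernel (S × A) ℝ := ⟨μ, hμm⟩
  let η : Kernel (S × A) ℝ := ⟨ν, hνm⟩
  have hκ : IsMarkovKernel κ := ⟨hμp⟩
  have hη : IsMarkovKernel η := ⟨hνp⟩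
  have hdiag : ∀ (w : S × A) (r : ℝ),
      mmdSq k ((μ w).map fun z => r + γ * z) ((ν w).map fun z => r + γ * z) ≤
        γ ^ (⨅ i, α i) * M ^ 2 := fun w r => by
    refine le_trans ?_ (mul_le_mul_of_nonneg_left (hM w) (Real.rpow_nonneg hγ0.le _))
    rw [mmdSq_sum (fun i _ => haff (hμμ · w) r i) (fun i _ => haff (hνν · w) r i)
        (fun i _ => haff (hμν · w) r i),
      mmdSq_sum (fun i _ => hμμ i w) (fun i _ => hνν i w) (fun i _ => hμν i w), Finset.mul_sum]
    refine Finset.sum_le_sum fun i _ => ?_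
    rw [mmdSq_map_affine (hkm i) (hshift i) (hscale i), abs_of_pos hγ0, mul_left_comm]
    refine mul_le_mul_of_nonneg_right ?_ (mul_nonneg (hc i) (hpos i _ _ inferInstance inferInstance
      (by simp) (hμμ i w) (hνν i w) (hμν i w)))
    exact Real.rpow_le_rpow_of_exponent_ge hγ0 hγ.2 (ciInf_le (Set.finite_range α).bddBelow i)
  refine iSup_le fun sa => ?_
  have hTμ : bellmanOp P R pol γ μ sa = affineKernel γ κ ∘ₘ (((P sa) ⊗ₘ pol).prod (R sa)) :=
    bellmanOp_eq_comp P R pol γ κ sa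
  have hTν : bellmanOp P R pol γ ν sa = affineKernel γ η ∘ₘ (((P sa) ⊗ₘ pol).prod (R sa)) :=
    bellmanOp_eq_comp P R pol γ η sa
  have hT : mmdSq k (bellmanOp P R pol γ μ sa) (bellmanOp P R pol γ ν sa) ≤
      γ ^ (⨅ i, α i) * M ^ 2 := by
    have iμμ : KernelIntegrable k (bellmanOp P R pol γ μ sa) (bellmanOp P R pol γ μ sa) :=
      KernelIntegrable.sum (fun i => hint i sa _ (by simp) _ (by simp)) c
    have iνν : KernelIntegrable k (bellmanOp P R pol γ ν sa) (bellmanOp P R pol γ ν sa) :=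
      KernelIntegrable.sum (fun i => hint i sa _ (by simp) _ (by simp)) c
    have iμν : KernelIntegrable k (bellmanOp P R pol γ μ sa) (bellmanOp P R pol γ ν sa) :=
      KernelIntegrable.sum (fun i => hint i sa _ (by simp) _ (by simp)) c
    rw [hTμ] at iμμ iμν ⊢
    rw [hTν] at iνν iμν ⊢
    refine hkpos.mmdSq_comp_le hksymm _ _ _ (fun u => ?_) (fun u => ?_) (fun u => ?_)
      iμμ iνν iμν fun u => ?_
    · rw [affineKernel_apply]
      exact KernelIntegrable.sum (haff (hμμ · u.1) u.2) c
    · rw [affineKernel_apply]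
      exact KernelIntegrable.sum (haff (hνν · u.1) u.2) c
    · rw [affineKernel_apply, affineKernel_apply]
      exact KernelIntegrable.sum (haff (hμν · u.1) u.2) c
    · rw [affineKernel_apply, affineKernel_apply]
      exact hdiag u.1 u.2
  have hmmd : mmd k (bellmanOp P R pol γ μ sa) (bellmanOp P R pol γ ν sa) ≤
      γ ^ ((⨅ i, α i) / 2) * M := by
    refine Real.sqrt_le_iff.2 ⟨mul_nonneg (Real.rpow_nonneg hγ0.le _) ENNReal.toReal_nonneg, ?_⟩
    rwa [mul_pow, ← Real.rpow_mul_natCast hγ0.le, Nat.cast_ofNat, div_mul_cancel₀ _ two_ne_zero]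
  calc ENNReal.ofReal (mmd k (bellmanOp P R pol γ μ sa) (bellmanOp P R pol γ ν sa))
      ≤ ENNReal.ofReal (γ ^ ((⨅ i, α i) / 2) * M) := ENNReal.ofReal_le_ofReal hmmd
    _ = ENNReal.ofReal (γ ^ ((⨅ i, α i) / 2)) * mmdSup k μ ν := by
      rw [ENNReal.ofReal_mul (Real.rpow_nonneg hγ0.le _), ENNReal.ofReal_toReal htop]
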